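/- For every integer d ≥ 3 there exists α₀ > 0 such that for every α > α₀, every δ > 0 with 2 d^{1/(α+1)} δ ≤ 1/d, and every semiflow Φ of the vector field F, every chain-recurrent point of Φ lies in S^δ ∪ {(U,U)}, where S^δ = {(u,v) ∈ D : ∑_{i=1}^d u_i v_i < 2 d^{1/(α+1)} δ} and U = (1/d, …, 1/d) ∈ ℝ^d. -/

import Mathlib

open Finset

/-- The closed simplex `Δ = {u : u_i ≥ 0, ∑ u_i = 1}`. -/
def simplexSet (d : ℕ) : Set (Fin d → ℝ) :=
  {u | (∀ i, 0 ≤ u i) ∧ ∑ i, u i = 1}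

/-- `D = Δ × Δ`. -/
def Dset (d : ℕ) : Set ((Fin d → ℝ) × (Fin d → ℝ)) :=
  {z | z.1 ∈ simplexSet d ∧ z.2 ∈ simplexSet d}

/-- `π_i(x) = f_δ(x_i)^{−α} / ∑_k f_δ(x_k)^{−α}` with `f_δ(x) = max(δ, x)`. -/
noncomputable def piv (d : ℕ) (δ α : ℝ) (x : Fin d → ℝ) (i : Fin d) : ℝ :=
  (max δ (x i)) ^ (-α) / ∑ k, (max δ (x k)) ^ (-α)

/-- The vector field `F(u,v) = (−u + π(v), −v + π(u))`. -/
noncomputable def Fvec (d : ℕ) (δ α : ℝ) (z : (Fin d → ℝ) × (Fin d → ℝ)) :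
    (Fin d → ℝ) × (Fin d → ℝ) :=
  (-z.1 + piv d δ α z.2, -z.2 + piv d δ α z.1)

/-- The `L¹` norm on `ℝ^{2d}`. -/
noncomputable def norm1 {d : ℕ} (z : (Fin d → ℝ) × (Fin d → ℝ)) : ℝ :=
  ∑ i, |z.1 i| + ∑ i, |z.2 i|

/-- A semiflow of the vector field `F` on `D`: a continuous map `Φ : [0,∞) × D → D` with
`Φ_0 = id`, `Φ_{t+s} = Φ_t ∘ Φ_s`, whose trajectories solve `ξ′ = F(ξ)` on `[0,∞)`. -/
noncomputable def IsSemiflow (d : ℕ) (δ α : ℝ)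
    (Φ : ℝ → ((Fin d → ℝ) × (Fin d → ℝ)) → ((Fin d → ℝ) × (Fin d → ℝ))) : Prop :=
  ContinuousOn (fun p : ℝ × ((Fin d → ℝ) × (Fin d → ℝ)) => Φ p.1 p.2)
      (Set.Ici 0 ×ˢ Dset d) ∧
    (∀ a ∈ Dset d, Φ 0 a = a) ∧
    (∀ a ∈ Dset d, ∀ t ≥ (0 : ℝ), Φ t a ∈ Dset d) ∧
    (∀ a ∈ Dset d, ∀ s ≥ (0 : ℝ), ∀ t ≥ (0 : ℝ), Φ (t + s) a = Φ t (Φ s a)) ∧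
    (∀ a ∈ Dset d, ∀ t ≥ (0 : ℝ),
      HasDerivWithinAt (fun s => Φ s a) (Fvec d δ α (Φ t a)) (Set.Ici 0) t)

/-- `z ∈ D` is chain-recurrent for `Φ`: for all `ρ > 0`, `T > 0` there are a chain
`z_0, …, z_k ∈ D` (`k ≥ 1`) with `z_k = z`, times `t_i ≥ T`, `‖z_0 − z‖₁ < ρ` and
`‖Φ_{t_i}(z_i) − z_{i+1}‖₁ < ρ`. -/
def ChainRecurrent (d : ℕ)
    (Φ : ℝ → ((Fin d → ℝ) × (Fin d → ℝ)) → ((Fin d → ℝ) × (Fin d → ℝ)))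
    (z : (Fin d → ℝ) × (Fin d → ℝ)) : Prop :=
  z ∈ Dset d ∧
    ∀ ρ > (0 : ℝ), ∀ T > (0 : ℝ),
      ∃ (k : ℕ) (zs : ℕ → (Fin d → ℝ) × (Fin d → ℝ)) (ts : ℕ → ℝ),
        1 ≤ k ∧ (∀ i ≤ k, zs i ∈ Dset d) ∧ zs k = z ∧
        (∀ i < k, T ≤ ts i) ∧ norm1 (zs 0 - z) < ρ ∧
        ∀ i < k, norm1 (Φ (ts i) (zs i) - zs (i + 1)) < ρ

/-- The overlap `H(u,v) = ∑ u_i v_i`. -/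
noncomputable def overlap {d : ℕ} (z : (Fin d → ℝ) × (Fin d → ℝ)) : ℝ :=
  ∑ i, z.1 i * z.2 i

lemma sub_mul_rpow_neg_le {m w α : ℝ} (hm : 0 < m) (hw : m ≤ w) (hα : 1 ≤ α) :
    (w - m) * w ^ (-α) ≤ m * m ^ (-α) / α := by
  have hα0 : 0 < α := by linarith
  have hr : 1 ≤ w / m := (one_le_div hm).2 hw
  have hb := one_add_mul_self_le_rpow_one_add (s := w / m - 1) (by linarith) hα
  rw [add_sub_cancel] at hb
  have hwm : w = m * (w / m) := by field_simp
  have hp : 0 < (w / m) ^ α := Real.rpow_pos_of_pos (by linarith) _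
  have e : w ^ (-α) = m ^ (-α) * ((w / m) ^ α)⁻¹ := by
    rw [← Real.rpow_neg (by linarith : 0 ≤ w / m), ← Real.mul_rpow hm.le (by linarith), ← hwm]
  have hmp : 0 < m ^ (-α) := Real.rpow_pos_of_pos hm _
  have key : (w / m - 1) * ((w / m) ^ α)⁻¹ ≤ 1 / α := by
    rw [← div_eq_mul_inv, div_le_div_iff₀ hp hα0]
    linarith
  calc (w - m) * w ^ (-α) = m * m ^ (-α) * ((w / m - 1) * ((w / m) ^ α)⁻¹) := by
        rw [e]; field_simp
    _ ≤ m * m ^ (-α) * (1 / α) := by gcongr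
    _ = _ := by ring

lemma piv_denom_pos {d : ℕ} (i₀ : Fin d) {δ : ℝ} (hδ : 0 < δ) (α : ℝ) (v : Fin d → ℝ) :
    0 < ∑ k, (max δ (v k)) ^ (-α) :=
  Finset.sum_pos (fun _ _ => Real.rpow_pos_of_pos (lt_max_of_lt_left hδ) _) ⟨i₀, mem_univ _⟩

lemma sum_piv {d : ℕ} (i₀ : Fin d) {δ : ℝ} (hδ : 0 < δ) (α : ℝ) (v : Fin d → ℝ) :
    ∑ i, piv d δ α v i = 1 := by
  simp only [piv]
  rw [← Finset.sum_div, div_self (piv_denom_pos i₀ hδ α v).ne']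

lemma sum_mul_piv_le {d : ℕ} {i₀ : Fin d} {δ α : ℝ} (hδ : 0 < δ) (hα : 1 ≤ α) {v : Fin d → ℝ}
    (hmin : ∀ i, v i₀ ≤ v i) :
    ∑ i, v i * piv d δ α v i ≤ max δ (v i₀) * (1 + d / α) := by
  set m := max δ (v i₀) with hm
  have hm0 : 0 < m := lt_max_of_lt_left hδ
  have hZ := piv_denom_pos i₀ hδ α v
  have hZm : m ^ (-α) ≤ ∑ k, (max δ (v k)) ^ (-α) :=
    Finset.single_le_sum (f := fun k => (max δ (v k)) ^ (-α))
      (fun k _ => Real.rpow_nonneg (lt_max_of_lt_left hδ).le _) (mem_univ i₀)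
  have h1 : ∑ i, (v i - m) * piv d δ α v i ≤ d * m / α := by
    have h2 : ∑ i, (v i - m) * (max δ (v i)) ^ (-α) ≤ ∑ _i : Fin d, m * m ^ (-α) / α := by
      refine Finset.sum_le_sum fun i _ => ?_
      refine le_trans ?_ (sub_mul_rpow_neg_le hm0 (max_le_max le_rfl (hmin i)) hα)
      have := Real.rpow_nonneg (lt_max_of_lt_left hδ : 0 < max δ (v i)).le (-α)
      gcongr
      exact le_max_right _ _
    simp only [piv, ← mul_div_assoc]
    rw [← Finset.sum_div, div_le_iff₀ hZ]
    refine h2.trans ?_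
    rw [Finset.sum_const, card_univ, Fintype.card_fin, nsmul_eq_mul]
    calc (d : ℝ) * (m * m ^ (-α) / α) = d * m / α * m ^ (-α) := by ring
      _ ≤ _ := by gcongr
  have h3 : ∑ i, (v i - m) * piv d δ α v i = ∑ i, v i * piv d δ α v i - m := by
    simp only [sub_mul, Finset.sum_sub_distrib, ← Finset.mul_sum, sum_piv i₀ hδ α v, mul_one]
  rw [h3] at h1
  calc _ ≤ m + d * m / α := by linarith
    _ = _ := by ring

lemma rpow_lt_one_sub_mul {d : ℕ} {α s : ℝ} (hd : 1 ≤ d) (hα : 2 * (d : ℝ) ^ 2 < α)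
    (hs : 0 < s) (hs' : s * (2 * d) ≤ 1) : (1 - s) ^ α < 1 - d * s := by
  have hd1 : (1 : ℝ) ≤ d := by exact_mod_cast hd
  have hs1 : s < 1 := by nlinarith
  have hα1 : 2 * (d : ℝ) < α := by nlinarith
  have hb := one_add_mul_self_le_rpow_one_add (s := (1 - s)⁻¹ - 1) (p := α)
    (by have : 0 < (1 - s)⁻¹ := inv_pos.2 (by linarith)
        linarith) (by linarith)
  rw [add_sub_cancel, Real.inv_rpow (by linarith)] at hb
  have hp : 0 < (1 - s) ^ α := Real.rpow_pos_of_pos (by linarith) _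
  have h1 : s ≤ (1 - s)⁻¹ - 1 := by
    rw [le_sub_iff_add_le, ← one_div, le_div_iff₀ (by linarith)]
    nlinarith
  have h2 : 1 + α * s ≤ ((1 - s) ^ α)⁻¹ := by nlinarith
  have hpos : 0 < 1 + α * s := by nlinarith
  have h3 : (1 - s) ^ α ≤ (1 + α * s)⁻¹ := (le_inv_comm₀ hpos hp).1 h2
  refine h3.trans_lt ?_
  rw [← one_div, div_lt_iff₀ hpos]
  nlinarith [mul_pos hs (sub_pos.2 hα1), mul_nonneg (mul_nonneg hs.le (by linarith : 0 ≤ α))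
    (sub_nonneg.2 hs')]

lemma mul_min_le_one {d : ℕ} {i₀ : Fin d} {v : Fin d → ℝ} (hv : v ∈ simplexSet d)
    (hmin : ∀ i, v i₀ ≤ v i) : d * v i₀ ≤ 1 := by
  have h := Finset.sum_le_sum (s := univ) (fun i _ => hmin i)
  rw [hv.2] at h
  simpa using h

lemma eq_uniform_of_mul_min_eq_one {d : ℕ} {i₀ : Fin d} {v : Fin d → ℝ} (hv : v ∈ simplexSet d)
    (hmin : ∀ i, v i₀ ≤ v i) (h : d * v i₀ = 1) : v = fun _ => 1 / (d : ℝ) := by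
  have hd : (d : ℝ) ≠ 0 := by rintro h0; simp [h0] at h
  have hs : ∑ i, (v i - v i₀) = 0 := by
    rw [Finset.sum_sub_distrib, hv.2]; simp [h]
  rw [Finset.sum_eq_zero_iff_of_nonneg fun i _ => sub_nonneg.2 (hmin i)] at hs
  funext i
  have := hs i (mem_univ i)
  field_simp
  nlinarith

/-- The self-interaction of `v` is controlled by its smallest coordinate. -/
lemma sum_mul_piv_lt {d : ℕ} {i₀ : Fin d} {δ α : ℝ} (hδ : 0 < δ)
    (hα : 2 * (d : ℝ) ^ 2 < α) {v : Fin d → ℝ} (hv : v ∈ simplexSet d)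
    (hmin : ∀ i, v i₀ ≤ v i) (hδm : δ ≤ v i₀) (hlt : d * v i₀ < 1) :
    ∑ i, v i * piv d δ α v i < 2 * v i₀ - d * v i₀ ^ 2 := by
  have hd : 1 ≤ d := Fin.pos i₀
  have hd1 : (1 : ℝ) ≤ d := by exact_mod_cast hd
  have hd0 : (0 : ℝ) < d := by linarith
  have hα1 : 1 ≤ α := by nlinarith
  have hα0 : 0 < α := by linarith
  set m := v i₀ with hm
  have hm0 : 0 < m := by linarith
  rcases lt_or_ge (1 : ℝ) ((1 - d * m) * (2 * d)) with hs | hs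
  · refine (sum_mul_piv_le hδ hα1 hmin).trans_lt ?_
    rw [max_eq_right hδm]
    have h1 : (d : ℝ) / α < 1 - d * m := by
      rw [div_lt_iff₀ hα0]; nlinarith
    nlinarith
  · have hr := rpow_lt_one_sub_mul hd hα (by linarith : 0 < 1 - d * m) hs
    rw [sub_sub_cancel] at hr
    have hvm : ∀ i, max δ (v i) = v i := fun i => max_eq_right (hδm.trans (hmin i))
    have hv0 : ∀ i, 0 < v i := fun i => hm0.trans_le (hmin i)
    set Z := ∑ k, (max δ (v k)) ^ (-α) with hZdef
    have hZ : 0 < Z := piv_denom_pos i₀ hδ α v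
    have hmp : 0 < m ^ (-α) := Real.rpow_pos_of_pos hm0 _
    have hZle : Z ≤ d * m ^ (-α) := by
      have : Z ≤ ∑ _k : Fin d, m ^ (-α) := Finset.sum_le_sum fun k _ => by
        rw [hvm]
        exact Real.rpow_le_rpow_of_nonpos hm0 (hmin k) (by linarith)
      simpa using this
    have hterm : ∀ i, (v i - 1 / d) * (v i ^ (-α) - (1 / (d : ℝ)) ^ (-α)) ≤ 0 := by
      intro i
      rcases le_total (v i) (1 / d) with h | h
      · have := Real.rpow_le_rpow_of_nonpos (hv0 i) h (by linarith : -α ≤ 0)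
        nlinarith
      · have := Real.rpow_le_rpow_of_nonpos (by positivity) h (by linarith : -α ≤ 0)
        nlinarith
    have hsum : ∑ i, (v i - 1 / d) * (v i ^ (-α) - (1 / (d : ℝ)) ^ (-α)) ≤
        (m - 1 / d) * (m ^ (-α) - (1 / (d : ℝ)) ^ (-α)) := by
      rw [← Finset.add_sum_erase _ _ (mem_univ i₀)]
      have := Finset.sum_nonpos (s := univ.erase i₀) fun i _ => hterm i
      linarith
    have hs0 : ∑ i, (v i - 1 / (d : ℝ)) = 0 := by
      rw [Finset.sum_sub_distrib, hv.2]; simp [hd0.ne']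
    have hpow : (1 / (d : ℝ)) ^ (-α) = m ^ (-α) * (d * m) ^ α := by
      rw [Real.mul_rpow hd0.le hm0.le, Real.rpow_neg hm0.le, one_div, Real.inv_rpow hd0.le,
        Real.rpow_neg hd0.le, inv_inv]
      have := (Real.rpow_pos_of_pos hm0 α).ne'
      field_simp
    have hG : (∑ i, v i * piv d δ α v i - 1 / d) * Z =
        ∑ i, (v i - 1 / d) * (v i ^ (-α) - (1 / (d : ℝ)) ^ (-α)) := by
      have e1 : (∑ i, v i * piv d δ α v i) * Z = ∑ i, v i * v i ^ (-α) := by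
        rw [Finset.sum_mul]
        refine Finset.sum_congr rfl fun i _ => ?_
        simp only [piv, ← hZdef]
        rw [hvm, mul_assoc, div_mul_cancel₀ _ hZ.ne']
      have e2 : Z = ∑ i, v i ^ (-α) := Finset.sum_congr rfl fun i _ => by rw [hvm]
      simp only [mul_sub, Finset.sum_sub_distrib, ← Finset.sum_mul, hs0, zero_mul, sub_zero]
      simp only [sub_mul, Finset.sum_sub_distrib, e1, ← Finset.mul_sum, ← e2]
    have hmd : 0 < 1 / (d : ℝ) - m := by
      rw [sub_pos, lt_div_iff₀ hd0]; linarith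
    have hfin : (∑ i, v i * piv d δ α v i - 1 / d) * Z < (-(d * (1 / d - m) ^ 2)) * Z := by
      rw [hG]
      refine hsum.trans_lt ?_
      rw [hpow]
      have h1 : d * (1 / d - m) ^ 2 * Z ≤ d * (1 / d - m) ^ 2 * (d * m ^ (-α)) := by gcongr
      have h2 : d * (1 / (d : ℝ) - m) * d < 1 - (d * m) ^ α := by
        have : d * (1 / (d : ℝ) - m) * d = d * (1 - d * m) := by field_simp
        linarith
      have h3 := mul_lt_mul_of_pos_left h2 (mul_pos hmd hmp)
      nlinarith
    have := lt_of_mul_lt_mul_right hfin hZ.le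
    have e : d * (1 / (d : ℝ) - m) ^ 2 = 1 / d - 2 * m + d * m ^ 2 := by field_simp; ring
    linarith

lemma sum_mul_piv_le_quadratic {d : ℕ} {i₀ : Fin d} {δ α : ℝ} (hδ : 0 < δ)
    (hα : 2 * (d : ℝ) ^ 2 < α) {v : Fin d → ℝ} (hv : v ∈ simplexSet d)
    (hmin : ∀ i, v i₀ ≤ v i) (hδm : δ ≤ v i₀) :
    ∑ i, v i * piv d δ α v i ≤ 2 * v i₀ - d * v i₀ ^ 2 := by
  rcases (mul_min_le_one hv hmin).lt_or_eq with h | h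
  · exact (sum_mul_piv_lt hδ hα hv hmin hδm h).le
  · have hu := eq_uniform_of_mul_min_eq_one hv hmin h
    have e : ∀ i, v i = v i₀ := fun i => by rw [hu]
    have : ∑ i, v i * piv d δ α v i = v i₀ := by
      simp only [e, ← Finset.mul_sum, sum_piv i₀ hδ, mul_one]
    rw [this]
    nlinarith

lemma overlap_ge {d : ℕ} {i₀ j₀ : Fin d} {u v : Fin d → ℝ} (hu : u ∈ simplexSet d)
    (hv : v ∈ simplexSet d) (hi : ∀ i, u i₀ ≤ u i) (hj : ∀ i, v j₀ ≤ v i) :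
    u i₀ + v j₀ - d * u i₀ * v j₀ ≤ ∑ i, u i * v i := by
  have h : 0 ≤ ∑ i, (u i - u i₀) * (v i - v j₀) :=
    Finset.sum_nonneg fun i _ => mul_nonneg (sub_nonneg.2 (hi i)) (sub_nonneg.2 (hj i))
  have e : ∑ i, (u i - u i₀) * (v i - v j₀) =
      ∑ i, u i * v i - v j₀ - u i₀ + d * u i₀ * v j₀ := by
    simp only [sub_mul, mul_sub, Finset.sum_sub_distrib, ← Finset.sum_mul, ← Finset.mul_sum,
      hu.2, hv.2, Finset.sum_const, card_univ, Fintype.card_fin, nsmul_eq_mul]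
    ring
  linarith

/-- The overlap strictly decreases along the vector field off the uniform point. -/
lemma sum_mul_piv_add_lt {d : ℕ} (hd : 3 ≤ d) {δ α : ℝ} (hδ : 0 < δ)
    (hα : 2 * (d : ℝ) ^ 2 < α) {z : (Fin d → ℝ) × (Fin d → ℝ)} (hz : z ∈ Dset d)
    (hH : 3 / 2 * δ ≤ overlap z)
    (hne : z ≠ ((fun _ => 1 / (d : ℝ)), (fun _ => 1 / (d : ℝ)))) :
    ∑ i, z.1 i * piv d δ α z.1 i + ∑ i, z.2 i * piv d δ α z.2 i < 2 * overlap z := by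
  obtain ⟨u, v⟩ := z
  obtain ⟨hu, hv⟩ := hz
  simp only [overlap] at *
  have hd3 : (3 : ℝ) ≤ d := by exact_mod_cast hd
  have hα0 : 1 ≤ α := by nlinarith
  have : NeZero d := ⟨by omega⟩
  obtain ⟨i₀, hi⟩ := Finite.exists_min u
  obtain ⟨j₀, hj⟩ := Finite.exists_min v
  have hge := overlap_ge hu hv hi hj
  have hdu := mul_min_le_one hu hi
  have hdv := mul_min_le_one hv hj
  have hu0 := hu.1 i₀
  have hv0 := hv.1 j₀
  have hK : 1 + d / α ≤ 7 / 6 := by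
    have : d / α ≤ 1 / 6 := by
      rw [div_le_iff₀ (by linarith)]; nlinarith
    linarith
  have hHu : u i₀ ≤ ∑ i, u i * v i := by nlinarith
  have hHv : v j₀ ≤ ∑ i, u i * v i := by nlinarith
  have hGu : ∑ i, u i * piv d δ α u i ≤ max δ (u i₀) * (7 / 6) :=
    (sum_mul_piv_le hδ hα0 hi).trans (by gcongr)
  have hGv : ∑ i, v i * piv d δ α v i ≤ max δ (v j₀) * (7 / 6) :=
    (sum_mul_piv_le hδ hα0 hj).trans (by gcongr)
  rcases le_total (u i₀) δ with h1 | h1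
  · rw [max_eq_left h1] at hGu
    rcases le_total (v j₀) δ with h2 | h2
    · rw [max_eq_left h2] at hGv
      linarith
    · rw [max_eq_right h2] at hGv
      linarith
  · rcases le_total (v j₀) δ with h2 | h2
    · rw [max_eq_right h1] at hGu
      rw [max_eq_left h2] at hGv
      linarith
    · have hQu := sum_mul_piv_le_quadratic hδ hα hu hi h1
      have hQv := sum_mul_piv_le_quadratic hδ hα hv hj h2
      have hsq : 2 * (d * u i₀ * v j₀) ≤ d * u i₀ ^ 2 + d * v j₀ ^ 2 := by
        nlinarith [mul_nonneg (by linarith : (0 : ℝ) ≤ d) (sq_nonneg (u i₀ - v j₀))]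
      rcases hdu.lt_or_eq with h3 | h3
      · have := sum_mul_piv_lt hδ hα hu hi h1 h3
        linarith
      · rcases hdv.lt_or_eq with h4 | h4
        · have := sum_mul_piv_lt hδ hα hv hj h2 h4
          linarith
        · exact absurd (Prod.ext (eq_uniform_of_mul_min_eq_one hu hi h3)
            (eq_uniform_of_mul_min_eq_one hv hj h4)) hne

lemma continuous_overlap {d : ℕ} :
    Continuous (overlap : (Fin d → ℝ) × (Fin d → ℝ) → ℝ) := by
  unfold overlap
  fun_prop

lemma isCompact_Dset (d : ℕ) : IsCompact (Dset d) :=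
  (isCompact_stdSimplex ℝ (Fin d)).prod (isCompact_stdSimplex ℝ (Fin d))

lemma le_one_of_mem_simplexSet {d : ℕ} {u : Fin d → ℝ} (hu : u ∈ simplexSet d) (i : Fin d) :
    u i ≤ 1 :=
  hu.2 ▸ Finset.single_le_sum (fun j _ => hu.1 j) (mem_univ i)

lemma overlap_sub_le_norm1 {d : ℕ} {p q : (Fin d → ℝ) × (Fin d → ℝ)} (hp : p ∈ Dset d)
    (hq : q ∈ Dset d) : overlap q - overlap p ≤ norm1 (p - q) := by
  simp only [overlap, norm1, ← Finset.sum_sub_distrib, ← Finset.sum_add_distrib]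
  refine Finset.sum_le_sum fun i _ => ?_
  simp only [Prod.fst_sub, Prod.snd_sub, Pi.sub_apply]
  have h1 := hq.2.1 i
  have h2 := le_one_of_mem_simplexSet hq.2 i
  have h3 := hp.1.1 i
  have h4 := le_one_of_mem_simplexSet hp.1 i
  have h5 : (q.1 i - p.1 i) * q.2 i ≤ |p.1 i - q.1 i| := by
    rw [abs_sub_comm]
    calc _ ≤ |q.1 i - p.1 i| * q.2 i := by gcongr; exact le_abs_self _
      _ ≤ _ := mul_le_of_le_one_right (abs_nonneg _) h2
  have h6 : p.1 i * (q.2 i - p.2 i) ≤ |p.2 i - q.2 i| := by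
    rw [abs_sub_comm]
    calc _ ≤ p.1 i * |q.2 i - p.2 i| := by gcongr; exact le_abs_self _
      _ ≤ _ := mul_le_of_le_one_left (abs_nonneg _) h4
  linarith

lemma norm_le_norm1 {d : ℕ} (z : (Fin d → ℝ) × (Fin d → ℝ)) : ‖z‖ ≤ norm1 z := by
  have h : ∀ u : Fin d → ℝ, ‖u‖ ≤ ∑ i, |u i| := fun u =>
    (pi_norm_le_iff_of_nonneg (Finset.sum_nonneg fun i _ => abs_nonneg _)).2 fun i =>
      Finset.single_le_sum (f := fun i => |u i|) (fun i _ => abs_nonneg _) (mem_univ i)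
  have h1 := h z.1
  have h2 := h z.2
  have n1 := norm_nonneg z.1
  have n2 := norm_nonneg z.2
  rw [Prod.norm_def, norm1]
  exact max_le (by linarith) (by linarith)

lemma overlap_uniform {d : ℕ} (hd : 1 ≤ d) :
    overlap ((fun _ => 1 / (d : ℝ)), (fun _ : Fin d => 1 / (d : ℝ))) = 1 / d := by
  have : (d : ℝ) ≠ 0 := by positivity
  simp [overlap, this]

section Semiflow

variable {d : ℕ} {δ α : ℝ}
  {Φ : ℝ → ((Fin d → ℝ) × (Fin d → ℝ)) → ((Fin d → ℝ) × (Fin d → ℝ))}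

lemma IsSemiflow.hasDerivWithinAt_overlap (hΦ : IsSemiflow d δ α Φ)
    {a : (Fin d → ℝ) × (Fin d → ℝ)} (ha : a ∈ Dset d) {t : ℝ} (ht : 0 ≤ t) :
    HasDerivWithinAt (fun s => overlap (Φ s a))
      (∑ i, (Φ t a).1 i * piv d δ α (Φ t a).1 i + ∑ i, (Φ t a).2 i * piv d δ α (Φ t a).2 i
        - 2 * overlap (Φ t a)) (Set.Ici 0) t := by
  have h := hΦ.2.2.2.2 a ha t ht
  have h1 := hasDerivWithinAt_pi.1 (hasFDerivAt_fst.comp_hasDerivWithinAt t h)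
  have h2 := hasDerivWithinAt_pi.1 (hasFDerivAt_snd.comp_hasDerivWithinAt t h)
  have h3 := HasDerivWithinAt.fun_sum (u := univ) fun i _ => (h1 i).mul (h2 i)
  refine h3.congr_deriv ?_
  simp only [overlap, Fvec, Finset.mul_sum, ← Finset.sum_sub_distrib, ← Finset.sum_add_distrib]
  refine Finset.sum_congr rfl fun i _ => ?_
  simp
  ring

lemma IsSemiflow.continuousOn_overlap (hΦ : IsSemiflow d δ α Φ) {t : ℝ} (ht : 0 ≤ t) :
    ContinuousOn (fun p => overlap (Φ t p)) (Dset d) :=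
  continuous_overlap.comp_continuousOn
    (hΦ.1.comp (f := fun p => (t, p)) (by fun_prop) fun _ hp => ⟨ht, hp⟩)

/-- Sublevel sets of the overlap away from the uniform point are forward invariant. -/
lemma IsSemiflow.overlap_le (hΦ : IsSemiflow d δ α Φ) (hd : 3 ≤ d) (hδ : 0 < δ)
    (hα : 2 * (d : ℝ) ^ 2 < α) {c : ℝ} (hc : 3 / 2 * δ ≤ c) (hcd : c ≠ 1 / d)
    {a : (Fin d → ℝ) × (Fin d → ℝ)} (ha : a ∈ Dset d) (hac : overlap a ≤ c) {t : ℝ}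
    (ht : 0 ≤ t) : overlap (Φ t a) ≤ c := by
  refine image_le_of_deriv_right_lt_deriv_boundary (f := fun s => overlap (Φ s a))
    (B := fun _ => c) (B' := fun _ => 0) (a := 0) (b := t)
    (fun s hs => (hΦ.hasDerivWithinAt_overlap ha hs.1).continuousWithinAt.mono
      Set.Icc_subset_Ici_self)
    (fun s hs => (hΦ.hasDerivWithinAt_overlap ha hs.1).mono (Set.Ici_subset_Ici.2 hs.1))
    (by simpa [hΦ.2.1 a ha] using hac) (fun s => hasDerivAt_const s c) ?_ ⟨ht, le_rfl⟩
  intro s hs hsc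
  have := sum_mul_piv_add_lt hd hδ hα (hΦ.2.2.1 a ha s hs.1) (hsc ▸ hc) (by
    intro h
    simp only [h, overlap_uniform (by omega : 1 ≤ d)] at hsc
    exact hcd hsc.symm)
  linarith

lemma IsSemiflow.overlap_lt (hΦ : IsSemiflow d δ α Φ) (hd : 3 ≤ d) (hδ : 0 < δ)
    (hα : 2 * (d : ℝ) ^ 2 < α) {c : ℝ} (hc : 3 / 2 * δ ≤ c) (hcd : c ≠ 1 / d)
    {a : (Fin d → ℝ) × (Fin d → ℝ)} (ha : a ∈ Dset d) (hac : overlap a ≤ c) {t : ℝ}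
    (ht : 0 < t) : overlap (Φ t a) < c := by
  refine (hΦ.overlap_le hd hδ hα hc hcd ha hac ht.le).lt_of_ne fun h => ?_
  have hmax : IsLocalMax (fun s => overlap (Φ s a)) t := by
    filter_upwards [Ioi_mem_nhds ht] with s hs
    exact (hΦ.overlap_le hd hδ hα hc hcd ha hac (le_of_lt hs)).trans h.ge
  have h0 := hmax.hasDerivAt_eq_zero
    ((hΦ.hasDerivWithinAt_overlap ha ht.le).hasDerivAt (Ici_mem_nhds ht))
  have := sum_mul_piv_add_lt hd hδ hα (hΦ.2.2.1 a ha t ht.le) (h ▸ hc) (by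
    intro h'
    rw [h', overlap_uniform (by omega : 1 ≤ d)] at h
    exact hcd h.symm)
  linarith

lemma IsSemiflow.exists_overlap_lt (hΦ : IsSemiflow d δ α Φ) (hd : 3 ≤ d) (hδ : 0 < δ)
    (hα : 2 * (d : ℝ) ^ 2 < α) {z : (Fin d → ℝ) × (Fin d → ℝ)} (hz : z ∈ Dset d)
    (hH : 3 / 2 * δ ≤ overlap z)
    (hne : z ≠ ((fun _ => 1 / (d : ℝ)), (fun _ => 1 / (d : ℝ)))) :
    ∃ t > 0, overlap (Φ t z) < overlap z := by
  have hder := hΦ.hasDerivWithinAt_overlap hz le_rfl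
  simp only [hΦ.2.1 z hz] at hder
  have hneg := sub_neg.2 (sum_mul_piv_add_lt hd hδ hα hz hH hne)
  have hev := hder.Ioi_of_Ici.limsup_slope_le' Set.self_notMem_Ioi hneg
  obtain ⟨t, ht, ht0⟩ := (hev.and self_mem_nhdsWithin).exists
  refine ⟨t, ht0, ?_⟩
  rw [slope_def_field, hΦ.2.1 z hz, sub_zero, div_lt_iff₀ ht0] at ht
  linarith

end Semiflow

/-- Lemma `limitrecurrent`: for every `d ≥ 3` there is `α₀ > 0` such that for
`α > α₀`, `δ > 0` with `2 d^{1/(α+1)} δ ≤ 1/d` and every semiflow `Φ` of `F`, every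
chain-recurrent point lies in `S^δ ∪ {(U,U)}`. -/
theorem stmt_5 (d : ℕ) (hd : 3 ≤ d) :
    ∃ α₀ : ℝ, 0 < α₀ ∧ ∀ α : ℝ, α₀ < α → ∀ δ : ℝ, 0 < δ →
      2 * (d : ℝ) ^ ((1 : ℝ) / (α + 1)) * δ ≤ 1 / d →
      ∀ Φ : ℝ → ((Fin d → ℝ) × (Fin d → ℝ)) → ((Fin d → ℝ) × (Fin d → ℝ)),
        IsSemiflow d δ α Φ →
        ∀ z, ChainRecurrent d Φ z →
          (∑ i, z.1 i * z.2 i < 2 * (d : ℝ) ^ ((1 : ℝ) / (α + 1)) * δ ∨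
            z = ((fun _ => 1 / (d : ℝ)), (fun _ => 1 / (d : ℝ)))) := by
  refine ⟨2 * (d : ℝ) ^ 2, by positivity, fun α hα δ hδ _ Φ hΦ z hz => ?_⟩
  obtain ⟨hzD, hch⟩ := hz
  by_contra hcon
  rw [not_or, not_lt] at hcon
  obtain ⟨hge, hne⟩ := hcon
  have hd1 : (1 : ℝ) ≤ d := by exact_mod_cast (by omega : 1 ≤ d)
  have hα0 : 0 < α := by nlinarith
  have hK : 1 ≤ (d : ℝ) ^ ((1 : ℝ) / (α + 1)) := Real.one_le_rpow hd1 (by positivity)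
  have hH : 3 / 2 * δ < overlap z := by
    rw [overlap]; nlinarith
  obtain ⟨t, ht, htz⟩ := hΦ.exists_overlap_lt hd hδ hα hzD hH.le hne
  obtain ⟨a, ⟨ha1, ha2⟩, had⟩ :=
    ((Set.Ioo_infinite (max_lt hH htz)).sdiff (Set.finite_singleton (1 / (d : ℝ)))).nonempty
  rw [max_lt_iff] at ha1
  have had : a ≠ 1 / d := had
  have hle := fun {p} => hΦ.overlap_le (a := p) hd hδ hα ha1.1.le had
  have hcomp : IsCompact (Dset d ∩ {p | overlap p ≤ a}) :=
    (isCompact_Dset d).inter_right (isClosed_le continuous_overlap continuous_const)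
  obtain ⟨q, hq, hqmax⟩ := hcomp.exists_isMaxOn
    ⟨Φ t z, hΦ.2.2.1 z hzD t ht.le, ha1.2.le⟩
    ((hΦ.continuousOn_overlap zero_le_one).mono Set.inter_subset_left)
  have hqlt := hΦ.overlap_lt hd hδ hα ha1.1.le had hq.1 hq.2 one_pos
  have hdrop : ∀ p ∈ Dset d, overlap p ≤ a → ∀ s, 1 ≤ s →
      overlap (Φ s p) ≤ overlap (Φ 1 q) := by
    intro p hp hpa s hs
    have e := hΦ.2.2.2.1 p hp (s - 1) (by linarith) 1 zero_le_one
    rw [add_sub_cancel] at e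
    rw [e]
    exact hqmax ⟨hΦ.2.2.1 p hp _ (by linarith), hle hp hpa (by linarith)⟩
  obtain ⟨ε, hε, hball⟩ := Metric.mem_nhdsWithin_iff.1
    ((hΦ.continuousOn_overlap ht.le z hzD).eventually_lt_const ha1.2)
  obtain ⟨k, zs, ts, hk, hD, hzk, hts, hz0, hjump⟩ :=
    hch (min ε (a - overlap (Φ 1 q))) (lt_min hε (sub_pos.2 hqlt)) (t + 1) (by linarith)
  have hstep : ∀ i < k, overlap (Φ (ts i) (zs i)) ≤ overlap (Φ 1 q) →
      overlap (zs (i + 1)) ≤ a := by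
    intro i hi h
    have h1 := overlap_sub_le_norm1
      (hΦ.2.2.1 _ (hD i hi.le) (ts i) (by linarith [hts i hi])) (hD (i + 1) hi)
    have h2 := (hjump i hi).trans_le (min_le_right _ _)
    linarith
  have hfirst : overlap (zs 1) ≤ a := by
    have hin : overlap (Φ t (zs 0)) < a := hball ⟨by
      rw [Metric.mem_ball, dist_eq_norm]
      exact (norm_le_norm1 _).trans_lt (hz0.trans_le (min_le_left _ _)), hD 0 (by omega)⟩
    have h0 := hts 0 (by omega)
    have e := hΦ.2.2.2.1 (zs 0) (hD 0 (by omega)) t ht.le (ts 0 - t) (by linarith)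
    rw [sub_add_cancel] at e
    refine hstep 0 (by omega) ?_
    rw [e]
    exact hdrop _ (hΦ.2.2.1 _ (hD 0 (by omega)) t ht.le) hin.le _ (by linarith)
  have hall : ∀ i, 1 ≤ i → i ≤ k → overlap (zs i) ≤ a := by
    intro i hi
    induction i, hi using Nat.le_induction with
    | base => exact fun _ => hfirst
    | succ n _ ih =>
      intro hn
      exact hstep n hn (hdrop _ (hD n (by omega)) (ih (by omega)) _ (by linarith [hts n hn]))
  have := hall k hk le_rfl
  rw [hzk] at this
  linarith
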